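/- arXiv:2507.15331 — 2 statements merged into one kernel-verified Lean document; each statement's English description precedes it below -/
import Mathlib

section
/- (Weighted Matrix-Tree Theorem) For a finite connected graph with positive edge weights y_e, any first cofactor of the weighted Laplacian equals the sum over all spanning trees T of the product of the weights of the edges of T. -/
open scoped Classical

/-- First cofactor of a square matrix. -/
def cof1 {n : ℕ} {F : Type*} [CommRing F] (Y : Matrix (Fin (n + 1)) (Fin (n + 1)) F)
    (j k : Fin (n + 1)) : F :=
  (-1 : F) ^ (j.val + k.val) * (Y.submatrix j.succAbove k.succAbove).det

/-- The weighted Laplacian of a graph `G` with edge weights `w`. -/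
noncomputable def weightedLaplacian {n : ℕ} (G : SimpleGraph (Fin (n + 2)))
    (w : Sym2 (Fin (n + 2)) → ℝ) : Matrix (Fin (n + 2)) (Fin (n + 2)) ℝ :=
  fun a b =>
    if a = b then ∑ x, (if G.Adj a x then w s(a, x) else 0)
    else if G.Adj a b then - w s(a, b) else 0

section helpers

set_option linter.unusedSectionVars false

variable {V : Type*} [Fintype V] [DecidableEq V]

/-- every vertex flows to the root. -/
def Reach (r : V) (f : V → V) : Prop := ∀ v, ∃ k : ℕ, f^[k] v = r

lemma iter_root {r : V} {f : V → V} (h : f r = r) (k : ℕ) : f^[k] r = r :=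
  Function.iterate_fixed h k

/-- Matrix with rows `e_v - e_{f v}` for `v ≠ r` and `e_r`. -/
def rowMat (r : V) (f : V → V) : Matrix V V ℝ :=
  fun v => if v = r then Pi.single r 1 else Pi.single v 1 - Pi.single (f v) 1

/-- The strict part. -/
def nilMat (r : V) (f : V → V) : Matrix V V ℝ :=
  fun v => if v = r then 0 else Pi.single (f v) 1

lemma rowMat_eq (r : V) (f : V → V) : rowMat r f = 1 - nilMat r f := by
  ext v u
  by_cases h : v = r
  · subst h; simp [rowMat, nilMat, Matrix.one_apply, Pi.single_apply, eq_comm]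
  · simp [rowMat, nilMat, Matrix.one_apply, Pi.single_apply, h, eq_comm]

lemma nilMat_pow {r : V} {f : V → V} (k : ℕ) :
    ∀ v u, f^[k] v = r → (nilMat r f ^ (k + 1)) v u = 0 := by
  induction k with
  | zero => intro v u h; simp at h; simp [nilMat, h]
  | succ k ih =>
    intro v u h
    rw [pow_succ', Matrix.mul_apply]
    by_cases hv : v = r
    · simp [nilMat, hv]
    · have := ih (f v) u (by simpa using h)
      apply Finset.sum_eq_zero
      intro x _
      by_cases hx : x = f v
      · subst hx; rw [this, mul_zero]
      · simp [nilMat, hv, hx]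

lemma det_rowMat_of_reach {r : V} {f : V → V} (h0 : f r = r) (h : Reach r f) :
    (rowMat r f).det = 1 := by
  choose k hk using h
  have hnil : IsNilpotent (nilMat r f) := by
    refine ⟨(∑ v, k v) + 1, ?_⟩
    ext v u
    apply nilMat_pow
    obtain ⟨d, hd⟩ := Nat.exists_eq_add_of_le
      (Finset.single_le_sum (f := k) (fun _ _ => Nat.zero_le _) (Finset.mem_univ v))
    rw [hd, add_comm, Function.iterate_add_apply, hk, iter_root h0]
  have h1 := (Matrix.isNilpotent_charpoly_sub_pow_of_isNilpotent hnil).eq_zero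
  rw [sub_eq_zero] at h1
  have h2 := Matrix.eval_charpoly (nilMat r f) 1
  rw [h1] at h2
  rw [rowMat_eq]
  simpa using h2.symm

lemma det_rowMat_of_not_reach {r : V} {f : V → V} (h : ¬ Reach r f) :
    (rowMat r f).det = 0 := by
  unfold Reach at h
  push Not at h
  obtain ⟨v, hv⟩ := h
  apply Matrix.exists_mulVec_eq_zero_iff.mp
  refine ⟨fun u => if ∃ k : ℕ, f^[k] u = r then 0 else 1, ?_, ?_⟩
  · intro h
    have := congrFun h v
    simp [hv] at this
  · ext u
    by_cases hu : u = r
    · subst hu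
      have : ∃ k : ℕ, f^[k] u = u := ⟨0, rfl⟩
      simp [Matrix.mulVec, rowMat, this]
    · have : (∃ k : ℕ, f^[k] u = r) ↔ ∃ k : ℕ, f^[k] (f u) = r := by
        constructor
        · rintro ⟨k, hk⟩
          cases k with
          | zero => exact absurd hk hu
          | succ k => exact ⟨k, by simpa using hk⟩
        · rintro ⟨k, hk⟩
          exact ⟨k + 1, by simpa using hk⟩
      simp only [Matrix.mulVec, rowMat, hu, if_false]
      change (Pi.single u 1 - Pi.single (f u) 1 : V → ℝ) ⬝ᵥ _ = 0
      rw [sub_dotProduct, single_one_dotProduct, single_one_dotProduct]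
      simp only [this, sub_self]

/-- Expansion of the determinant with general weights. -/
lemma det_expand (r : V) (c : V → V → ℝ) (M : Matrix V V ℝ)
    (hr : M r = Pi.single r 1)
    (hM : ∀ v, v ≠ r → M v = ∑ x, c v x • (Pi.single v 1 - Pi.single x 1 : V → ℝ)) :
    M.det = ∑ f : V → V, if f r = r ∧ Reach r f then
      ∏ v ∈ Finset.univ.erase r, c v (f v) else 0 := by
  set c' : V → V → ℝ := fun v x => if v = r then (if x = r then 1 else 0) else c v x with hc'
  set R : V → V → V → ℝ := fun v x =>
    if v = r then Pi.single r 1 else Pi.single v 1 - Pi.single x 1 with hR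
  have hMM : M = fun v => ∑ x, c' v x • R v x := by
    funext v
    by_cases h : v = r
    · subst h; simp [hc', hR, hr]
    · simp only [hc', hR, h, if_false]; exact hM v h
  have : M.det = Matrix.detRowAlternating.toMultilinearMap (fun v => ∑ x, c' v x • R v x) := by
    rw [hMM]; rfl
  rw [this, MultilinearMap.map_sum]
  apply Finset.sum_congr rfl
  intro f _
  rw [MultilinearMap.map_smul_univ]
  have h3 : (Matrix.detRowAlternating.toMultilinearMap fun i => R i (f i)) = (rowMat r f).det := rfl
  rw [h3, ← Finset.mul_prod_erase Finset.univ _ (Finset.mem_univ r)]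
  have h4 : ∏ v ∈ Finset.univ.erase r, c' v (f v) = ∏ v ∈ Finset.univ.erase r, c v (f v) := by
    apply Finset.prod_congr rfl
    intro v hv
    simp [hc', Finset.ne_of_mem_erase hv]
  rw [h4]
  by_cases h0 : f r = r
  · by_cases h : Reach r f
    · simp [hc', h0, h, det_rowMat_of_reach h0 h]
    · simp [h, det_rowMat_of_not_reach h]
  · simp [hc', h0]

/-- Graph of a parent function. -/
def parGraph (r : V) (f : V → V) : SimpleGraph V :=
  SimpleGraph.fromEdgeSet {e | ∃ v, v ≠ r ∧ e = s(v, f v)}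

lemma no_two_cycle {r : V} {f : V → V} (h : Reach r f) {v u : V} (hv : v ≠ r) (hu : u ≠ r)
    (h1 : f v = u) (h2 : f u = v) : False := by
  obtain ⟨k, hk⟩ := h v
  have : ∀ k : ℕ, f^[k] v = v ∨ f^[k] v = u := by
    intro k
    induction k with
    | zero => left; rfl
    | succ k ih =>
      rw [Function.iterate_succ_apply']
      rcases ih with h | h
      · right; rw [h, h1]
      · left; rw [h, h2]
  rcases this k with h | h
  · exact hv (h.symm.trans hk)
  · exact hu (h.symm.trans hk)

lemma edge_inj {r : V} {f : V → V} (h : Reach r f) :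
    Set.InjOn (fun v => s(v, f v)) {v | v ≠ r} := by
  intro v hv u hu huv
  simp only [Sym2.eq_iff] at huv
  rcases huv with ⟨h1, _⟩ | ⟨h1, h2⟩
  · exact h1
  · exact (no_two_cycle h hv hu h2 h1.symm).elim

lemma par_ne {r : V} {f : V → V} (h : Reach r f) {v : V} (hv : v ≠ r) : v ≠ f v := by
  intro h'
  exact no_two_cycle h hv hv h'.symm h'.symm

lemma parGraph_edgeSet {r : V} {f : V → V} (h : Reach r f) :
    (parGraph r f).edgeSet = {e | ∃ v, v ≠ r ∧ e = s(v, f v)} := by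
  rw [parGraph, SimpleGraph.edgeSet_fromEdgeSet]
  ext e
  simp only [Set.mem_sdiff, Set.mem_setOf_eq, and_iff_left_iff_imp]
  rintro ⟨v, hv, rfl⟩
  simpa using par_ne h hv

lemma parGraph_edgeFinset {r : V} {f : V → V} (h : Reach r f)
    [Fintype (parGraph r f).edgeSet] :
    (parGraph r f).edgeFinset = (Finset.univ.erase r).image (fun v => s(v, f v)) := by
  ext e
  rw [SimpleGraph.mem_edgeFinset, parGraph_edgeSet h]
  simp [eq_comm]

lemma parGraph_edge_prod {r : V} {f : V → V} (h : Reach r f)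
    [Fintype (parGraph r f).edgeSet] (w : Sym2 V → ℝ) :
    ∏ e ∈ (parGraph r f).edgeFinset, w e = ∏ v ∈ Finset.univ.erase r, w s(v, f v) := by
  rw [parGraph_edgeFinset h, Finset.prod_image]
  intro v hv u hu
  exact edge_inj h (by simpa using hv) (by simpa using hu)

lemma parGraph_card {r : V} {f : V → V} (h : Reach r f)
    [Fintype (parGraph r f).edgeSet] :
    (parGraph r f).edgeFinset.card + 1 = Fintype.card V := by
  rw [parGraph_edgeFinset h, Finset.card_image_of_injOn, Finset.card_erase_add_one (by simp),
    Finset.card_univ]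
  intro v hv u hu
  exact edge_inj h (by simpa using hv) (by simpa using hu)

lemma parGraph_adj {r : V} {f : V → V} (h : Reach r f) {v : V} (hv : v ≠ r) :
    (parGraph r f).Adj v (f v) := by
  rw [← SimpleGraph.mem_edgeSet, parGraph_edgeSet h]
  exact ⟨v, hv, rfl⟩

lemma parGraph_isTree {r : V} {f : V → V} (h : Reach r f) : (parGraph r f).IsTree := by
  rw [SimpleGraph.isTree_iff_connected_and_card]
  constructor
  · have key : ∀ (k : ℕ) (v : V), f^[k] v = r → (parGraph r f).Reachable v r := by
      intro k
      induction k with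
      | zero => intro v hv; simp at hv; rw [hv]
      | succ k ih =>
        intro v hv
        by_cases hvr : v = r
        · rw [hvr]
        · exact (parGraph_adj h hvr).reachable.trans (ih _ (by simpa using hv))
    have : ∀ v, (parGraph r f).Reachable v r := fun v => by
      obtain ⟨k, hk⟩ := h v
      exact key k v hk
    have hne : Nonempty V := ⟨r⟩
    exact ⟨fun u v => (this u).trans (this v).symm⟩
  · have := parGraph_card h
    rw [SimpleGraph.edgeFinset_card] at this
    rw [Nat.card_eq_fintype_card, Nat.card_eq_fintype_card, this]

lemma parGraph_inj {r : V} {f g : V → V} (hf0 : f r = r) (hg0 : g r = r)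
    (hf : Reach r f) (hg : Reach r g) (h : parGraph r f = parGraph r g) : f = g := by
  have step : ∀ v, f v ≠ g v → f (f v) ≠ g (f v) := by
    intro v hv
    have hvr : v ≠ r := by rintro rfl; exact hv (hf0.trans hg0.symm)
    have h1 := parGraph_adj hf hvr
    rw [h, ← SimpleGraph.mem_edgeSet, parGraph_edgeSet hg] at h1
    obtain ⟨u, hu, h1⟩ := h1
    rw [Sym2.eq_iff] at h1
    rcases h1 with ⟨rfl, h1⟩ | ⟨h1, h2⟩
    · exact absurd h1 hv
    · intro h3
      rw [h2, ← h1] at h3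
      exact no_two_cycle hf hvr hu h2 h3
  funext v
  by_contra hv
  have : ∀ k : ℕ, f (f^[k] v) ≠ g (f^[k] v) := by
    intro k
    induction k with
    | zero => exact hv
    | succ k ih => rw [Function.iterate_succ_apply']; exact step _ ih
  obtain ⟨k, hk⟩ := hf v
  apply this k
  rw [hk, hf0, hg0]

lemma exists_par {r : V} {T : SimpleGraph V} (hT : T.IsTree) :
    ∃ f : V → V, f r = r ∧ Reach r f ∧ parGraph r f = T := by
  have hex : ∀ v, ∃ u, (v = r → u = r) ∧ (v ≠ r → T.Adj v u ∧ T.dist u r < T.dist v r) := by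
    intro v
    by_cases hv : v = r
    · exact ⟨r, by simp [hv]⟩
    · obtain ⟨p, hp⟩ := (hT.connected v r).exists_walk_length_eq_dist
      cases p with
      | nil => exact absurd rfl hv
      | cons hadj q =>
        rename_i u
        refine ⟨u, fun h => absurd h hv, fun _ => ⟨hadj, ?_⟩⟩
        have := SimpleGraph.dist_le q
        simp at hp
        omega
  choose f hf0 hf using hex
  have hR : Reach r f := by
    have : ∀ (d : ℕ) (v : V), T.dist v r ≤ d → ∃ k : ℕ, f^[k] v = r := by
      intro d
      induction d with
      | zero =>
        intro v hv
        exact ⟨0, (hT.connected v r).dist_eq_zero_iff.mp (by omega)⟩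
      | succ d ih =>
        intro v hv
        by_cases hvr : v = r
        · exact ⟨0, hvr⟩
        · obtain ⟨k, hk⟩ := ih (f v) (by have := (hf v hvr).2; omega)
          exact ⟨k + 1, by simpa using hk⟩
    exact fun v => this _ v le_rfl
  refine ⟨f, hf0 r rfl, hR, ?_⟩
  rw [← SimpleGraph.edgeFinset_inj]
  apply Finset.eq_of_subset_of_card_le
  · intro e he
    rw [SimpleGraph.mem_edgeFinset, parGraph_edgeSet hR] at he
    obtain ⟨v, hv, rfl⟩ := he
    rw [SimpleGraph.mem_edgeFinset]
    exact (hf v hv).1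
  · have h1 := parGraph_card hR
    have h2 := hT.card_edgeFinset
    omega

lemma sum_par_eq (r : V) (G : SimpleGraph V) (w : Sym2 V → ℝ) :
    (∑ f : V → V, if f r = r ∧ Reach r f then
      ∏ v ∈ Finset.univ.erase r, (if G.Adj v (f v) then w s(v, f v) else 0) else 0) =
    ∑ T : SimpleGraph V, if T ≤ G ∧ T.IsTree then ∏ e ∈ T.edgeFinset, w e else 0 := by
  have h1 : ∀ f : V → V, (if f r = r ∧ Reach r f then
      ∏ v ∈ Finset.univ.erase r, (if G.Adj v (f v) then w s(v, f v) else 0) else 0) =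
      if (f r = r ∧ Reach r f) ∧ parGraph r f ≤ G then
        ∏ e ∈ (parGraph r f).edgeFinset, w e else 0 := by
    intro f
    by_cases h : f r = r ∧ Reach r f
    · rw [if_pos h, parGraph_edge_prod h.2]
      by_cases hG : parGraph r f ≤ G
      · rw [if_pos ⟨h, hG⟩]
        apply Finset.prod_congr rfl
        intro v hv
        rw [if_pos (hG (parGraph_adj h.2 (Finset.ne_of_mem_erase hv)))]
      · rw [if_neg (fun h => hG h.2)]
        have : ∃ v, v ≠ r ∧ ¬ G.Adj v (f v) := by
          by_contra! hc
          apply hG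
          rw [← SimpleGraph.edgeSet_subset_edgeSet, parGraph_edgeSet h.2]
          rintro e ⟨v, hv, rfl⟩
          exact hc v hv
        obtain ⟨v, hv, hv'⟩ := this
        exact Finset.prod_eq_zero (i := v) (by simp [hv]) (by simp [hv'])
    · rw [if_neg h, if_neg (fun h' => h h'.1)]
  simp_rw [h1]
  rw [← Finset.sum_filter, ← Finset.sum_filter]
  apply Finset.sum_bij (fun f _ => parGraph r f)
  · intro f hf
    simp only [Finset.mem_filter, Finset.mem_univ, true_and] at hf ⊢
    exact ⟨hf.2, parGraph_isTree hf.1.2⟩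
  · intro f hf g hg h
    simp only [Finset.mem_filter, Finset.mem_univ, true_and] at hf hg
    exact parGraph_inj hf.1.1 hg.1.1 hf.1.2 hg.1.2 h
  · intro T hT
    simp only [Finset.mem_filter, Finset.mem_univ, true_and] at hT
    obtain ⟨f, h0, hR, rfl⟩ := exists_par (r := r) hT.2
    exact ⟨f, by simp [h0, hR, hT.1], rfl⟩
  · intro f hf
    rfl

lemma adj_const_left (A : Matrix V V ℝ) (h : ∀ i, ∑ x, A i x = 0) (i i' j : V) :
    A.adjugate i j = A.adjugate i' j := by
  rw [Matrix.adjugate_apply, Matrix.adjugate_apply, ← sub_eq_zero]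
  have h1 : (A.updateRow j (Pi.single i 1 - Pi.single i' 1)).det = 0 := by
    apply Matrix.exists_mulVec_eq_zero_iff.mp
    refine ⟨fun _ => 1, fun h => by simpa using congrFun h i, ?_⟩
    ext u
    by_cases hu : u = j
    · subst hu
      simp only [Matrix.mulVec, Matrix.updateRow_self]
      change (Pi.single i 1 - Pi.single i' 1 : V → ℝ) ⬝ᵥ _ = 0
      rw [sub_dotProduct, single_one_dotProduct, single_one_dotProduct, sub_self]
    · simp [Matrix.mulVec, dotProduct, hu, h]
  have h2 := Matrix.det_updateRow_add A j (Pi.single i 1 - Pi.single i' 1) (Pi.single i' 1)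
  rw [h1, sub_add_cancel] at h2
  rw [h2]; simp

lemma adj_const (A : Matrix V V ℝ) (hs : A.IsSymm) (h : ∀ i, ∑ x, A i x = 0) (i j r : V) :
    A.adjugate i j = A.adjugate r r := by
  rw [adj_const_left A h i r j]
  have h3 : ∀ a b, A.adjugate a b = A.adjugate b a := by
    intro a b
    have := Matrix.adjugate_transpose A
    rw [hs.eq] at this
    exact (congrFun (congrFun this a) b).symm
  rw [h3, adj_const_left A h j r r]

end helpers

/-- Weighted Matrix-Tree Theorem: for a finite connected graph with positive edge weights,
any first cofactor of the weighted Laplacian equals the sum over all spanning trees of the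
product of the weights of the tree's edges. -/
theorem weighted_matrix_tree {n : ℕ} (G : SimpleGraph (Fin (n + 2)))
    (hG : G.Connected)
    (w : Sym2 (Fin (n + 2)) → ℝ) (hw : ∀ e ∈ G.edgeSet, 0 < w e)
    (j k : Fin (n + 2)) :
    cof1 (weightedLaplacian G w) j k =
      ∑ T : SimpleGraph (Fin (n + 2)),
        if T ≤ G ∧ T.IsTree then ∏ e ∈ T.edgeFinset, w e else 0 := by
  have hsum : ∀ i, ∑ x, weightedLaplacian G w i x = 0 := by
    intro i
    rw [← Finset.add_sum_erase _ _ (Finset.mem_univ i)]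
    have : ∑ x ∈ Finset.univ.erase i, weightedLaplacian G w i x =
        ∑ x ∈ Finset.univ.erase i, - (if G.Adj i x then w s(i, x) else 0) := by
      apply Finset.sum_congr rfl
      intro x hx
      have := (Finset.ne_of_mem_erase hx).symm
      simp only [weightedLaplacian, this, if_false]
      split_ifs <;> simp
    rw [this, Finset.sum_neg_distrib]
    simp only [weightedLaplacian, if_true]
    rw [← Finset.add_sum_erase _ _ (Finset.mem_univ i)]
    simp
  have hsymm : (weightedLaplacian G w).IsSymm := by
    ext a b
    by_cases h : a = b
    · subst h; rfl
    · simp [weightedLaplacian, h, Ne.symm h, G.adj_comm a b, Sym2.eq_swap]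
  have h1 : cof1 (weightedLaplacian G w) j k = (weightedLaplacian G w).adjugate k j := by
    rw [Matrix.adjugate_fin_succ_eq_det_submatrix]; rfl
  rw [h1, adj_const _ hsymm hsum k j 0, Matrix.adjugate_apply, ← sum_par_eq 0 G w]
  apply det_expand 0 (fun v x => if G.Adj v x then w s(v, x) else 0)
  · simp
  · intro v hv
    ext u
    rw [Matrix.updateRow_ne hv]
    by_cases h : v = u
    · subst h
      simp only [weightedLaplacian, if_true, Finset.sum_apply]
      apply Finset.sum_congr rfl
      intro x _
      by_cases hx : G.Adj v x
      · simp [hx, Pi.single_apply, hx.ne]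
      · simp [hx]
    · rw [Finset.sum_apply, Finset.sum_eq_single u]
      · by_cases hx : G.Adj v u
        · simp [weightedLaplacian, h, hx, Pi.single_apply, Ne.symm h]
        · simp [weightedLaplacian, h, hx]
      · intro x _ hx
        simp [Pi.single_apply, Ne.symm h, Ne.symm hx]
      · simp
end

section
/- (Rayleigh monotonicity) In a connected network with positive real branch admittances, the driving-point impedance Z_{jk} is a nonincreasing function of each individual branch admittance; explicitly, if branch α joins nodes p and q, then ∂Z_{jk}/∂y_α = −(T_{pq,jk})², where T_{pq,jk} = C_{pq,jk}(Y)/c(Y) is the transfer impedance. In particular ∂Z_{jk}/∂y_α ≤ 0, with equality iff C_{pq,jk}(Y) = 0. -/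
/-- Index of `p` in the minor obtained by deleting index `j` (for `p ≠ j`). -/
def delIdx {n : ℕ} (j p : Fin (n + 2)) : Fin (n + 1) :=
  ⟨if j.val < p.val then p.val - 1 else min p.val n, by split <;> omega⟩

/-- The second cofactor `C_{ab,cd}(Y)`: rows `a, b` and columns `c, d` deleted, with the sign
`(-1)^(σ(a,b)+σ(c,d))`, realized recursively as `(-1)^(a+c)` times the first cofactor of the
`(a,c)` minor at the shifted indices; zero by convention when `a = b` or `c = d`. -/
def cof2 {n : ℕ} {F : Type*} [CommRing F] (Y : Matrix (Fin (n + 2)) (Fin (n + 2)) F)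
    (a b c d : Fin (n + 2)) : F :=
  if a = b ∨ c = d then 0 else
    (-1 : F) ^ (a.val + c.val) *
      cof1 (Y.submatrix a.succAbove c.succAbove) (delIdx a b) (delIdx c d)
/-- The weighted graph Laplacian (admittance matrix) of branch admittances `y`. -/
def lap {m : ℕ} (y : Fin m → Fin m → ℝ) : Matrix (Fin m) (Fin m) ℝ :=
  fun a b => if a = b then ∑ x, y a x else - y a b


theorem cof1_eq_adj {n : ℕ} {F : Type*} [CommRing F] (Y : Matrix (Fin (n + 1)) (Fin (n + 1)) F)
    (j k : Fin (n + 1)) : cof1 Y j k = Y.adjugate k j := by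
  rw [Matrix.adjugate_fin_succ_eq_det_submatrix, cof1]

theorem adj_const_left_s17 {m : ℕ} (Y : Matrix (Fin m) (Fin m) ℝ)
    (hr : Y.mulVec 1 = 0) (k k' j : Fin m) : Y.adjugate k j = Y.adjugate k' j := by
  have h0 : (Y.updateRow j (Pi.single k 1 + (-1 : ℝ) • Pi.single k' 1)).det = 0 := by
    rw [← Matrix.exists_mulVec_eq_zero_iff]
    refine ⟨1, ?_, ?_⟩
    · intro h
      have := congrFun h j
      simp at this
    · funext i
      by_cases hi : i = j
      · subst hi
        simp [Matrix.mulVec, dotProduct, Finset.sum_add_distrib]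
      · have := congrFun hr i
        simpa [Matrix.mulVec, dotProduct, Matrix.updateRow_ne hi] using this
  rw [Matrix.det_updateRow_add, Matrix.det_updateRow_smul] at h0
  rw [Matrix.adjugate_apply, Matrix.adjugate_apply]
  linarith

theorem cof1_const {n : ℕ} (Y : Matrix (Fin (n + 1)) (Fin (n + 1)) ℝ)
    (hr : Y.mulVec 1 = 0) (hc : Y.transpose.mulVec 1 = 0) (j k : Fin (n + 1)) :
    cof1 Y j k = cof1 Y 0 0 := by
  rw [cof1_eq_adj, cof1_eq_adj, adj_const_left_s17 Y hr k 0 j]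
  have := adj_const_left_s17 Y.transpose hc j 0 0
  rw [← Matrix.adjugate_transpose] at this
  exact this

theorem det_add_single {m : ℕ} (A : Matrix (Fin m) (Fin m) ℝ) (b d : Fin m) :
    (A + Matrix.single b d 1).det = A.det + A.adjugate d b := by
  have : A + Matrix.single b d 1 = A.updateRow b (A b + Pi.single d 1) := by
    ext i l
    by_cases hi : i = b
    · subst hi
      simp [Matrix.single_apply, Pi.single_apply, eq_comm]
    · simp [Matrix.updateRow_ne hi, Matrix.single_apply, Ne.symm hi]
  rw [this, Matrix.det_updateRow_add, Matrix.updateRow_eq_self, Matrix.adjugate_apply]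

theorem succAbove_delIdx {n : ℕ} (a b : Fin (n + 2)) (h : a ≠ b) :
    a.succAbove (delIdx a b) = b := by
  have h' : a.val ≠ b.val := fun e => h (Fin.ext e)
  have := a.isLt
  have := b.isLt
  apply Fin.ext
  unfold delIdx Fin.succAbove
  simp only [Fin.lt_def, Fin.val_castSucc]
  split_ifs <;> simp at * <;> omega

/-- difference of two basis vectors -/
def dv {m : ℕ} (a b : Fin m) : Fin m → ℝ := Pi.single a 1 - Pi.single b 1

theorem sum_dv {m : ℕ} (a b : Fin m) : ∑ i, dv a b i = 0 := by
  simp [dv]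

theorem zero_row {m : ℕ} (Y : Matrix (Fin m) (Fin m) ℝ) (hr : Y.mulVec 1 = 0)
    (u : Fin m → ℝ) (c d : Fin m) : (Y + Matrix.vecMulVec u (dv c d)).mulVec 1 = 0 := by
  rw [Matrix.add_mulVec, hr]
  funext i
  simp [Matrix.mulVec, dotProduct, Matrix.vecMulVec_apply, ← Finset.mul_sum, sum_dv]

theorem zero_col {m : ℕ} (Y : Matrix (Fin m) (Fin m) ℝ) (hc : Y.transpose.mulVec 1 = 0)
    (v : Fin m → ℝ) (a b : Fin m) :
    (Y + Matrix.vecMulVec (dv a b) v).transpose.mulVec 1 = 0 := by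
  rw [Matrix.transpose_add, Matrix.transpose_vecMulVec]
  exact zero_row _ hc _ _ _

theorem cof2_eq {n : ℕ} (Y : Matrix (Fin (n + 2)) (Fin (n + 2)) ℝ)
    (hr : Y.mulVec 1 = 0) (hc : Y.transpose.mulVec 1 = 0) (a b c d : Fin (n + 2)) :
    cof2 Y a b c d = cof1 (Y + Matrix.vecMulVec (dv a b) (dv c d)) 0 0 - cof1 Y 0 0 := by
  unfold cof2
  split_ifs with h
  · have : Matrix.vecMulVec (dv a b) (dv c d) = 0 := by
      rcases h with h | h <;> subst h <;> ext <;> simp [dv, Matrix.vecMulVec_apply]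
    simp [this]
  · push Not at h
    rw [← cof1_const _ (zero_row Y hr _ _ _) (zero_col Y hc _ _ _) a c,
      ← cof1_const Y hr hc a c, cof1_eq_adj (Y.submatrix _ _)]
    unfold cof1
    have hs : (Y + Matrix.vecMulVec (dv a b) (dv c d)).submatrix a.succAbove c.succAbove
        = Y.submatrix a.succAbove c.succAbove
          + Matrix.single (delIdx a b) (delIdx c d) 1 := by
      ext i l
      have e1 : (b = a.succAbove i) ↔ (delIdx a b = i) := by
        conv_lhs => rw [← succAbove_delIdx a b h.1]
        exact Fin.succAbove_right_inj
      have e2 : (d = c.succAbove l) ↔ (delIdx c d = l) := by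
        conv_lhs => rw [← succAbove_delIdx c d h.2]
        exact Fin.succAbove_right_inj
      simp only [Matrix.submatrix_apply, Matrix.add_apply, Matrix.vecMulVec_apply, dv,
        Pi.sub_apply, Pi.single_apply, Fin.succAbove_ne, Matrix.single_apply,
        eq_comm (a := a.succAbove i) (b := b), eq_comm (a := c.succAbove l) (b := d), e1, e2]
      by_cases h1 : delIdx a b = i <;> by_cases h2 : delIdx c d = l <;> simp [h1, h2]
    rw [hs, det_add_single]
    ring

/-- the grounded matrix -/
def red {n : ℕ} (Y : Matrix (Fin (n + 1)) (Fin (n + 1)) ℝ) : Matrix (Fin n) (Fin n) ℝ :=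
  Y.submatrix Fin.succ Fin.succ

theorem cof1_zero {n : ℕ} (Y : Matrix (Fin (n + 1)) (Fin (n + 1)) ℝ) :
    cof1 Y 0 0 = (red Y).det := by
  have : (Fin.succAbove (0 : Fin (n + 1))) = Fin.succ := by
    funext i; simp
  simp [cof1, red, this]

theorem det_rank2 {m : ℕ} (A : Matrix (Fin m) (Fin m) ℝ) (hA : IsUnit A.det)
    (u v w z : Fin m → ℝ) (t s : ℝ) :
    (A + t • Matrix.vecMulVec u v + s • Matrix.vecMulVec w z).det =
      A.det * ((1 + t * (v ⬝ᵥ A⁻¹.mulVec u)) * (1 + s * (z ⬝ᵥ A⁻¹.mulVec w))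
        - t * s * (v ⬝ᵥ A⁻¹.mulVec w) * (z ⬝ᵥ A⁻¹.mulVec u)) := by
  have e : A + t • Matrix.vecMulVec u v + s • Matrix.vecMulVec w z
      = A + (Matrix.of ![t • u, s • w]).transpose * (Matrix.of ![v, z]) := by
    ext i l
    simp [Matrix.mul_apply, Fin.sum_univ_two, Matrix.vecMulVec_apply]
    ring
  have key : ∀ a b : Fin 2, ((Matrix.of ![v, z]) * A⁻¹ * (Matrix.of ![t • u, s • w]).transpose) a b
      = (![v, z] a) ⬝ᵥ A⁻¹.mulVec (![t • u, s • w] b) := by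
    intro a b
    rw [Matrix.dotProduct_mulVec]
    rfl
  rw [e, Matrix.det_add_mul _ _ hA, Matrix.det_fin_two]
  simp only [Matrix.add_apply, key]
  simp [Matrix.mulVec_smul]
  left
  ring

theorem lap_row {m : ℕ} (y : Fin m → Fin m → ℝ) (hdiag : ∀ a, y a a = 0) :
    (lap y).mulVec 1 = 0 := by
  funext i
  have : ∀ b, lap y i b = (if i = b then ∑ x, y i x else 0) - y i b := by
    intro b
    unfold lap
    split_ifs with h
    · subst h; simp [hdiag]
    · simp
  simp [Matrix.mulVec, dotProduct, this]

theorem lap_symm {m : ℕ} (y : Fin m → Fin m → ℝ) (hsym : ∀ a b, y a b = y b a) :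
    (lap y).transpose = lap y := by
  ext a b
  simp only [Matrix.transpose_apply, lap]
  by_cases h : a = b
  · subst h; simp
  · simp [h, Ne.symm h, hsym a b]

theorem lap_quad {m : ℕ} (y : Fin m → Fin m → ℝ) (hsym : ∀ a b, y a b = y b a)
    (hdiag : ∀ a, y a a = 0) (x : Fin m → ℝ) :
    2 * (x ⬝ᵥ (lap y).mulVec x) = ∑ a, ∑ b, y a b * (x a - x b) ^ 2 := by
  have h1 : ∀ a b, lap y a b = (if a = b then ∑ x, y a x else 0) - y a b := by
    intro a b
    unfold lap
    split_ifs with h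
    · subst h; simp [hdiag]
    · simp
  have h2 : x ⬝ᵥ (lap y).mulVec x = ∑ a, ∑ b, y a b * (x a ^ 2 - x a * x b) := by
    simp only [dotProduct, Matrix.mulVec, h1]
    refine Finset.sum_congr rfl fun a _ => ?_
    simp only [sub_mul, Finset.sum_sub_distrib, mul_sub, ite_mul, zero_mul, Finset.sum_ite_eq,
      Finset.mem_univ, if_true, ← Finset.sum_mul, Finset.mul_sum]
    congr 1
    · ring
    · exact Finset.sum_congr rfl fun b _ => by ring
  have h3 : x ⬝ᵥ (lap y).mulVec x = ∑ a, ∑ b, y a b * (x b ^ 2 - x a * x b) := by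
    rw [h2, Finset.sum_comm]
    refine Finset.sum_congr rfl fun a _ => Finset.sum_congr rfl fun b _ => ?_
    rw [hsym b a]; ring
  rw [two_mul]
  nth_rewrite 1 [h2]
  rw [h3]
  simp only [← Finset.sum_add_distrib]
  refine Finset.sum_congr rfl fun a _ => Finset.sum_congr rfl fun b _ => ?_
  ring

theorem red_det_ne {n : ℕ} (y : Fin (n + 1) → Fin (n + 1) → ℝ)
    (hsym : ∀ a b, y a b = y b a) (hdiag : ∀ a, y a a = 0) (hnn : ∀ a b, 0 ≤ y a b)
    (hconn : (SimpleGraph.fromRel fun u v => 0 < y u v).Connected) :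
    (red (lap y)).det ≠ 0 := by
  intro h
  obtain ⟨x, hx0, hx⟩ := Matrix.exists_mulVec_eq_zero_iff.mpr h
  set X : Fin (n + 1) → ℝ := Fin.cons 0 x with hX
  have hq : X ⬝ᵥ (lap y).mulVec X = 0 := by
    have hrow : ∀ i : Fin n, (lap y).mulVec X i.succ = 0 := by
      intro i
      have := congrFun hx i
      simpa [Matrix.mulVec, dotProduct, Fin.sum_univ_succ, hX, red] using this
    have hX0 : X 0 = 0 := by simp [hX]
    simp [dotProduct, Fin.sum_univ_succ, hrow, hX0]
  have hs := lap_quad y hsym hdiag X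
  rw [hq, mul_zero] at hs
  have hnn2 : ∀ a b, 0 ≤ y a b * (X a - X b) ^ 2 := fun a b => mul_nonneg (hnn a b) (sq_nonneg _)
  have hz : ∀ a b, y a b * (X a - X b) ^ 2 = 0 := by
    intro a b
    have h1 := (Finset.sum_eq_zero_iff_of_nonneg
      (fun a _ => Finset.sum_nonneg fun b _ => hnn2 a b)).mp hs.symm a (Finset.mem_univ _)
    exact (Finset.sum_eq_zero_iff_of_nonneg (fun b _ => hnn2 a b)).mp h1 b (Finset.mem_univ _)
  have hadj : ∀ a b, (SimpleGraph.fromRel fun u v => 0 < y u v).Adj a b → X a = X b := by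
    intro a b hab
    rw [SimpleGraph.fromRel_adj] at hab
    have hp : 0 < y a b := by
      rcases hab.2 with h | h
      · exact h
      · rw [hsym]; exact h
    have := hz a b
    rcases mul_eq_zero.mp this with h | h
    · exact absurd h hp.ne'
    · exact sub_eq_zero.mp (pow_eq_zero_iff (two_ne_zero)|>.mp h)
  have hreach : ∀ a b, X a = X b := by
    intro a b
    obtain ⟨w⟩ := hconn.preconnected a b
    induction w with
    | nil => rfl
    | cons h _ ih => exact (hadj _ _ h).trans ih
  apply hx0
  funext i
  have := hreach i.succ 0
  simpa [hX] using this

theorem lap_pert {m : ℕ} (y : Fin m → Fin m → ℝ) (hsym : ∀ a b, y a b = y b a)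
    (p q : Fin m) (hpq : p ≠ q) (t : ℝ) :
    lap (fun u v => if (u = p ∧ v = q) ∨ (u = q ∧ v = p) then t else y u v)
      = lap y + (t - y p q) • Matrix.vecMulVec (dv p q) (dv p q) := by
  have hf : ∀ u v, (if (u = p ∧ v = q) ∨ (u = q ∧ v = p) then t else y u v)
      = y u v + ((if u = p then (if v = q then t - y p q else 0) else 0)
        + (if u = q then (if v = p then t - y p q else 0) else 0)) := by
    intro u v
    by_cases h1 : u = p <;> by_cases h2 : v = q <;> by_cases h3 : u = q <;>
      by_cases h4 : v = p <;> simp_all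
  ext a b
  simp only [lap, hf, Matrix.add_apply, Matrix.smul_apply, Matrix.vecMulVec_apply, dv,
    Pi.sub_apply, Pi.single_apply, smul_eq_mul, Finset.sum_add_distrib]
  by_cases hab : a = b
  · subst hab
    by_cases h1 : a = p <;> by_cases h3 : a = q <;> simp_all
  · by_cases h1 : a = p <;> by_cases h2 : b = q <;> by_cases h3 : a = q <;>
      by_cases h4 : b = p <;> simp_all <;> ring

/-- Rayleigh monotonicity: in a connected network with positive real branch admittances,
the driving-point impedance `Z_{jk}` is nonincreasing in each individual branch admittance;
explicitly, if the branch `α` joins nodes `p ≠ q`, then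
`∂Z_{jk}/∂y_α = −(T_{pq,jk})²` where `T_{pq,jk} = C_{pq,jk}(Y)/c(Y)` is the transfer
impedance; in particular `∂Z_{jk}/∂y_α ≤ 0`, with equality iff `C_{pq,jk}(Y) = 0`. -/
theorem rayleigh_monotonicity {n : ℕ}
    (y : Fin (n + 2) → Fin (n + 2) → ℝ)
    (hsym : ∀ a b, y a b = y b a) (hdiag : ∀ a, y a a = 0) (hnn : ∀ a b, 0 ≤ y a b)
    (hconn : (SimpleGraph.fromRel fun u v => 0 < y u v).Connected)
    (p q j k : Fin (n + 2)) (hpq : p ≠ q) (hy : 0 < y p q) :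
    let Yt : ℝ → Matrix (Fin (n + 2)) (Fin (n + 2)) ℝ := fun t =>
      lap (fun u v => if (u = p ∧ v = q) ∨ (u = q ∧ v = p) then t else y u v)
    let Zf : ℝ → ℝ := fun t => cof2 (Yt t) j k j k / cof1 (Yt t) 0 0
    let T : ℝ := cof2 (lap y) p q j k / cof1 (lap y) 0 0
    deriv Zf (y p q) = -(T ^ 2) ∧
    deriv Zf (y p q) ≤ 0 ∧
    (deriv Zf (y p q) = 0 ↔ cof2 (lap y) p q j k = 0) := by
  intro Yt Zf T
  set Y := lap y with hY
  have hr : Y.mulVec 1 = 0 := lap_row y hdiag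
  have hT : Y.transpose = Y := lap_symm y hsym
  have hc : Y.transpose.mulVec 1 = 0 := by rw [hT]; exact hr
  set A := red Y with hA
  have hdet : A.det ≠ 0 := red_det_ne y hsym hdiag hnn hconn
  have hu : IsUnit A.det := isUnit_iff_ne_zero.mpr hdet
  have hAT : A.transpose = A := by
    rw [hA, red, Matrix.transpose_submatrix, hT]
  set u : Fin (n + 1) → ℝ := fun i => dv p q i.succ with hudef
  set w : Fin (n + 1) → ℝ := fun i => dv j k i.succ with hwdef
  have hYt : ∀ t, Yt t = Y + (t - y p q) • Matrix.vecMulVec (dv p q) (dv p q) :=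
    fun t => lap_pert y hsym p q hpq t
  have hYt' : ∀ t, Yt t = Y + Matrix.vecMulVec ((t - y p q) • dv p q) (dv p q) := by
    intro t; rw [hYt, Matrix.smul_vecMulVec]
  have hYt'' : ∀ t, Yt t = Y + Matrix.vecMulVec (dv p q) ((t - y p q) • dv p q) := by
    intro t; rw [hYt, Matrix.vecMulVec_smul]
  have hrt : ∀ t, (Yt t).mulVec 1 = 0 := by
    intro t; rw [hYt']; exact zero_row _ hr _ _ _
  have hct : ∀ t, (Yt t).transpose.mulVec 1 = 0 := by
    intro t; rw [hYt'']; exact zero_col _ hc _ _ _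
  set a := u ⬝ᵥ A⁻¹.mulVec u with ha
  set b := w ⬝ᵥ A⁻¹.mulVec w with hb
  set d := w ⬝ᵥ A⁻¹.mulVec u with hd
  have hd' : u ⬝ᵥ A⁻¹.mulVec w = d := by
    rw [hd, Matrix.dotProduct_mulVec, dotProduct_comm, ← Matrix.mulVec_transpose,
      Matrix.transpose_nonsing_inv, hAT]
  have hc1 : ∀ t, cof1 (Yt t) 0 0 = A.det * (1 + (t - y p q) * a) := by
    intro t
    have e : red (Yt t) = A + (t - y p q) • Matrix.vecMulVec u u
        + (0 : ℝ) • Matrix.vecMulVec w w := by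
      rw [hYt]; ext i l; simp [red, hA, Matrix.vecMulVec_apply, hudef]
    rw [cof1_zero, e, det_rank2 A hu]
    ring
  have hc2 : ∀ t, cof2 (Yt t) j k j k
      = A.det * (b + (t - y p q) * (a * b - d ^ 2)) := by
    intro t
    have e : red (Yt t + Matrix.vecMulVec (dv j k) (dv j k))
        = A + (t - y p q) • Matrix.vecMulVec u u + (1 : ℝ) • Matrix.vecMulVec w w := by
      rw [hYt]; ext i l; simp [red, hA, Matrix.vecMulVec_apply, hudef, hwdef]
    rw [cof2_eq _ (hrt t) (hct t), hc1, cof1_zero, e, det_rank2 A hu, hd']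
    ring
  have hc0 : cof1 Y 0 0 = A.det := cof1_zero Y
  have hcT : cof2 Y p q j k = A.det * d := by
    have e : red (Y + Matrix.vecMulVec (dv p q) (dv j k))
        = A + (1 : ℝ) • Matrix.vecMulVec u w + (0 : ℝ) • Matrix.vecMulVec w w := by
      ext i l; simp [red, hA, Matrix.vecMulVec_apply, hudef, hwdef]
    rw [cof2_eq _ hr hc, hc0, cof1_zero, e, det_rank2 A hu]
    ring
  have hTd : T = d := by
    change cof2 Y p q j k / cof1 Y 0 0 = d
    rw [hcT, hc0]; field_simp
  have hZ : Zf = fun t => (b + (t - y p q) * (a * b - d ^ 2)) / (1 + (t - y p q) * a) := by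
    funext t
    change cof2 (Yt t) j k j k / cof1 (Yt t) 0 0 = _
    rw [hc1, hc2, mul_div_mul_left _ _ hdet]
  have hder : deriv Zf (y p q) = -(T ^ 2) := by
    rw [hZ, hTd]
    have hlin : ∀ e : ℝ, HasDerivAt (fun t : ℝ => (t - y p q) * e) e (y p q) := by
      intro e
      simpa using ((hasDerivAt_id (y p q)).sub_const (y p q)).mul_const e
    have h1 := (hlin (a * b - d ^ 2)).const_add b
    have h2 := (hlin a).const_add 1
    have h3 := h1.fun_div h2 (by simp)
    rw [h3.deriv]
    simp
    ring
  refine ⟨hder, ?_, ?_⟩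
  · rw [hder]; nlinarith [sq_nonneg T]
  · rw [hder, hTd, hcT]
    simp [hdet]
end
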